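/- arXiv:1811.02747 — 2 statements merged into one kernel-verified Lean document; each statement's English description precedes it below -/
import Mathlib

section
/- Let k ≥ 2 be an integer. Suppose there exists a pseudo k-regular finite simple graph on n vertices which contains k − 1 distinct edges each of whose two endpoints have degree k. Then for every positive integer m there exists a pseudo k-regular finite simple graph on n + m·(k − 1) vertices. -/
open Finset

open scoped Classical in
/-- `G` is pseudo `k`-regular: it has no isolated vertices, it is `k`-harmonic
(`∑_{j ~ i} d_j = k·d_i` for all `i`, i.e. `m_i = k`), and it is not regular. -/
noncomputable def SimpleGraph.IsPseudoRegular {V : Type*} [Fintype V]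
    (G : SimpleGraph V) (k : ℕ) : Prop :=
  (∀ i : V, 0 < G.degree i) ∧
  (∀ i : V, ∑ j ∈ G.neighborFinset i, G.degree j = k * G.degree i) ∧
  ¬ ∃ d : ℕ, ∀ i : V, G.degree i = d

namespace SimpleGraph

variable {V W : Type*}

/-- Delete the edges in `E` from `G`, add a complete graph on `E`, and join each `e ∈ E` to both
of its endpoints. -/
def cliqueSubdivide (G : SimpleGraph V) (E : Finset (Sym2 V)) : SimpleGraph (V ⊕ E) where
  Adj
    | .inl a, .inl b => G.Adj a b ∧ s(a, b) ∉ E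
    | .inl a, .inr e => a ∈ e.1
    | .inr e, .inl a => a ∈ e.1
    | .inr e, .inr f => e ≠ f
  symm := ⟨by
    rintro (a | e) (b | f) h
    · exact ⟨h.1.symm, by rw [Sym2.eq_swap]; exact h.2⟩
    · exact h
    · exact h
    · exact h.symm⟩
  loopless := ⟨by
    rintro (a | e) h
    · exact G.loopless.irrefl a h.1
    · exact h rfl⟩

section

variable {G : SimpleGraph V} {E : Finset (Sym2 V)}

@[simp]
lemma cliqueSubdivide_adj_inl_inl {a b : V} :
    (G.cliqueSubdivide E).Adj (.inl a) (.inl b) ↔ G.Adj a b ∧ s(a, b) ∉ E := Iff.rfl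

@[simp]
lemma cliqueSubdivide_adj_inl_inr {a : V} {e : E} :
    (G.cliqueSubdivide E).Adj (.inl a) (.inr e) ↔ a ∈ e.1 := Iff.rfl

@[simp]
lemma cliqueSubdivide_adj_inr_inl {a : V} {e : E} :
    (G.cliqueSubdivide E).Adj (.inr e) (.inl a) ↔ a ∈ e.1 := Iff.rfl

@[simp]
lemma cliqueSubdivide_adj_inr_inr {e f : E} :
    (G.cliqueSubdivide E).Adj (.inr e) (.inr f) ↔ e ≠ f := Iff.rfl

variable [Fintype V]

open scoped Classical in
lemma sum_neighborFinset_cliqueSubdivide_inl (hE : (E : Set (Sym2 V)) ⊆ G.edgeSet)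
    (F : V ⊕ E → ℕ) (a : V) :
    ∑ x ∈ (G.cliqueSubdivide E).neighborFinset (.inl a), F x =
      ∑ b ∈ G.neighborFinset a, if h : s(a, b) ∈ E then F (.inr ⟨s(a, b), h⟩) else F (.inl b) := by
  symm
  refine Finset.sum_bij
    (fun b _ ↦ if h : s(a, b) ∈ E then .inr ⟨s(a, b), h⟩ else .inl b) ?_ ?_ ?_ ?_
  · intro b hb
    rw [mem_neighborFinset] at hb ⊢
    split_ifs with h
    · simp
    · simpa using ⟨hb, h⟩
  · intro b _ c _ hbc
    split_ifs at hbc with h₁ h₂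
    · exact Sym2.congr_right.1 (Subtype.ext_iff.1 (Sum.inr.inj hbc))
    · simpa using hbc
  · rintro (b | ⟨e, he⟩) hx
    · rw [mem_neighborFinset, cliqueSubdivide_adj_inl_inl] at hx
      exact ⟨b, by simpa using hx.1, by simp [hx.2]⟩
    · rw [mem_neighborFinset, cliqueSubdivide_adj_inl_inr] at hx
      obtain ⟨b, rfl⟩ := hx
      exact ⟨b, by simpa using hE he, by simp [he]⟩
  · intro b _
    split_ifs <;> rfl

open scoped Classical in
lemma sum_neighborFinset_cliqueSubdivide_inr (F : V ⊕ E → ℕ) (e : E) :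
    ∑ x ∈ (G.cliqueSubdivide E).neighborFinset (.inr e), F x =
      ∑ a ∈ e.1.toFinset, F (.inl a) + ∑ f ∈ univ.erase e, F (.inr f) := by
  have : (G.cliqueSubdivide E).neighborFinset (.inr e) =
      e.1.toFinset.disjSum (univ.erase e) := by
    ext (a | f) <;> simp [eq_comm]
  rw [this, Finset.sum_disjSum]

open scoped Classical in
lemma degree_cliqueSubdivide_inl (hE : (E : Set (Sym2 V)) ⊆ G.edgeSet) (a : V) :
    (G.cliqueSubdivide E).degree (.inl a) = G.degree a := by
  have := sum_neighborFinset_cliqueSubdivide_inl hE (fun _ ↦ 1) a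
  simpa using this

open scoped Classical in
lemma degree_cliqueSubdivide_inr (hE : (E : Set (Sym2 V)) ⊆ G.edgeSet) (e : E) :
    (G.cliqueSubdivide E).degree (.inr e) = E.card + 1 := by
  have h := sum_neighborFinset_cliqueSubdivide_inr (G := G) (fun _ ↦ 1) e
  have he : e.1.toFinset.card = 2 :=
    Sym2.card_toFinset_of_not_isDiag _ (G.not_isDiag_of_mem_edgeSet (hE e.2))
  have hpos : 0 < E.card := Finset.card_pos.2 ⟨e.1, e.2⟩
  simp [he] at h
  omega

lemma IsPseudoRegular.cliqueSubdivide {k : ℕ} (hG : G.IsPseudoRegular k)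
    (hE : (E : Set (Sym2 V)) ⊆ G.edgeSet) (hcard : E.card + 1 = k)
    (hdeg : ∀ e ∈ E, ∀ v ∈ e, (open scoped Classical in G.degree v) = k) :
    (G.cliqueSubdivide E).IsPseudoRegular k := by
  classical
  obtain ⟨hpos, hsum, hreg⟩ := hG
  refine ⟨?_, ?_, ?_⟩
  · rintro (a | e)
    · rw [degree_cliqueSubdivide_inl hE]
      exact hpos a
    · rw [degree_cliqueSubdivide_inr hE]
      omega
  · rintro (a | e)
    · rw [sum_neighborFinset_cliqueSubdivide_inl hE, degree_cliqueSubdivide_inl hE, ← hsum]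
      refine Finset.sum_congr rfl fun b _ ↦ ?_
      split_ifs with h
      · rw [degree_cliqueSubdivide_inr hE, hcard, hdeg _ h b (by simp)]
      · exact degree_cliqueSubdivide_inl hE b
    · have hk : ∀ x ∈ (G.cliqueSubdivide E).neighborFinset (.inr e),
          (G.cliqueSubdivide E).degree x = k := by
        rintro (a | f) hx
        · rw [degree_cliqueSubdivide_inl hE]
          exact hdeg _ e.2 a (by simpa using hx)
        · rw [degree_cliqueSubdivide_inr hE, hcard]
      rw [Finset.sum_congr rfl hk, Finset.sum_const, card_neighborFinset_eq_degree, smul_eq_mul,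
        mul_comm]
  · rintro ⟨d, hd⟩
    exact hreg ⟨d, fun i ↦ by rw [← degree_cliqueSubdivide_inl hE i, hd]⟩

open scoped Classical in
lemma exists_edges_cliqueSubdivide {k : ℕ} (hE : (E : Set (Sym2 V)) ⊆ G.edgeSet)
    (hcard : E.card + 1 = k) (hdeg : ∀ e ∈ E, ∀ v ∈ e, G.degree v = k) :
    ∃ E' : Finset (Sym2 (V ⊕ E)), E'.card = E.card ∧
      (E' : Set (Sym2 (V ⊕ E))) ⊆ (G.cliqueSubdivide E).edgeSet ∧
      ∀ e ∈ E', ∀ v ∈ e, (G.cliqueSubdivide E).degree v = k := by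
  refine ⟨univ.image fun e : E ↦ s(.inl e.1.out.1, .inr e), ?_, ?_, ?_⟩
  · rw [Finset.card_image_of_injective _ fun e f h ↦ ?_]
    · simp
    · simp at h
      exact h.2
  · intro x hx
    obtain ⟨e, rfl⟩ : ∃ e : E, s(.inl e.1.out.1, .inr e) = x := by simpa using hx
    exact Sym2.out_fst_mem e.1
  · intro x hx v hv
    obtain ⟨e, rfl⟩ : ∃ e : E, s(.inl e.1.out.1, .inr e) = x := by simpa using hx
    obtain rfl | rfl := Sym2.mem_iff.1 hv
    · rw [degree_cliqueSubdivide_inl hE]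
      exact hdeg _ e.2 _ (Sym2.out_fst_mem e.1)
    · rw [degree_cliqueSubdivide_inr hE, hcard]

end

lemma IsPseudoRegular.of_iso [Fintype V] [Fintype W] {G : SimpleGraph V} {H : SimpleGraph W}
    (φ : G ≃g H) {k : ℕ} (hG : G.IsPseudoRegular k) : H.IsPseudoRegular k := by
  classical
  obtain ⟨hpos, hsum, hreg⟩ := hG
  have hdeg : ∀ i, H.degree (φ i) = G.degree i := fun i ↦ φ.degree_eq i
  refine ⟨fun i ↦ ?_, fun i ↦ ?_, ?_⟩
  · obtain ⟨i, rfl⟩ := φ.surjective i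
    rw [hdeg]
    exact hpos i
  · obtain ⟨i, rfl⟩ := φ.surjective i
    rw [hdeg, ← hsum]
    symm
    refine Finset.sum_equiv φ.toEquiv (fun j ↦ ?_) fun j _ ↦ (hdeg j).symm
    simp only [mem_neighborFinset]
    exact φ.map_adj_iff.symm
  · rintro ⟨d, hd⟩
    exact hreg ⟨d, fun i ↦ by rw [← hdeg, hd]⟩

end SimpleGraph

open scoped Classical in
/-- Let `k ≥ 2`. If there is a pseudo `k`-regular graph on `n`
vertices containing `k − 1` distinct edges each of whose two endpoints have degree `k`,
then for every positive integer `m` there is a pseudo `k`-regular graph on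
`n + m·(k − 1)` vertices. -/
theorem pseudoRegular_extension (k n : ℕ) (hk : 2 ≤ k)
    (h : ∃ G : SimpleGraph (Fin n), G.IsPseudoRegular k ∧
      ∃ E : Finset (Sym2 (Fin n)), E.card = k - 1 ∧ (E : Set (Sym2 (Fin n))) ⊆ G.edgeSet ∧
        ∀ e ∈ E, ∀ v ∈ e, G.degree v = k) :
    ∀ m : ℕ, 0 < m →
      ∃ H : SimpleGraph (Fin (n + m * (k - 1))), H.IsPseudoRegular k := by
  obtain ⟨G, hG, E, hE⟩ := h
  have key : ∀ m : ℕ, ∃ (V : Type) (_ : Fintype V) (H : SimpleGraph V),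
      Fintype.card V = n + m * (k - 1) ∧ H.IsPseudoRegular k ∧
      ∃ E : Finset (Sym2 V), E.card = k - 1 ∧ (E : Set (Sym2 V)) ⊆ H.edgeSet ∧
        ∀ e ∈ E, ∀ v ∈ e, H.degree v = k := by
    intro m
    induction m with
    | zero => exact ⟨Fin n, inferInstance, G, by simp, hG, E, hE⟩
    | succ m ih =>
      obtain ⟨V, _, H, hV, hH, E, hcard, hE, hdeg⟩ := ih
      have hcard' : E.card + 1 = k := by omega
      refine ⟨V ⊕ E, inferInstance, H.cliqueSubdivide E, ?_,
        hH.cliqueSubdivide hE hcard' hdeg, ?_⟩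
      · rw [Fintype.card_sum, hV, Fintype.card_coe, hcard]
        ring
      · rw [← hcard]
        exact SimpleGraph.exists_edges_cliqueSubdivide hE hcard' hdeg
  intro m _
  obtain ⟨V, _, H, hV, hH, -⟩ := key m
  exact ⟨_, hH.of_iso (SimpleGraph.Iso.map (Fintype.equivFinOfCardEq hV) H)⟩
end

section
/- Let k ≥ 3 be an integer. If k is odd, then there exists a pseudo k-regular finite simple graph on k + 4 vertices; if k is even, then there exists a pseudo k-regular finite simple graph on k + 6 vertices. In particular, the minimum number N(k) of vertices of a pseudo k-regular graph satisfies N(k) ≤ k + 4 for odd k and N(k) ≤ k + 6 for even k. -/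
open Finset

/-- The graph on `Fin n` in which `i ≠ j` are adjacent when bit `j` of `rows i` or bit `i` of
`rows j` is set. -/
def SimpleGraph.ofRows {n : ℕ} (rows : Fin n → ℕ) : SimpleGraph (Fin n) :=
  SimpleGraph.fromRel fun i j => (rows i).testBit j = true

instance {n : ℕ} (rows : Fin n → ℕ) : DecidableRel (SimpleGraph.ofRows rows).Adj :=
  fun i j => inferInstanceAs (Decidable (i ≠ j ∧ _))

namespace SimpleGraph

/-- A graph `B` and a weight `e` such that `B` has degrees `m - e i`, the weights of the neighbours
of `i` sum to `s - e i`, and the total weight is `t`. If `B` has `k + m + 1` vertices and `s = t`,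
then `e` is the excess `d_i - k` of the degrees in `Bᶜ`, and `Bᶜ` is `k`-harmonic. -/
def IsCoExcess {V : Type*} [Fintype V] (B : SimpleGraph V) [DecidableRel B.Adj] (e : V → ℤ)
    (m s t : ℤ) : Prop :=
  (∀ i, -3 < e i) ∧ (∃ i j, e i ≠ e j) ∧
  (∀ i, ∑ j, (if B.Adj i j then 1 else 0) = m - e i) ∧
  (∀ i, ∑ j, (if B.Adj i j then e j else 0) = s - e i) ∧
  ∑ i, e i = t

instance {V : Type*} [Fintype V] (B : SimpleGraph V) [DecidableRel B.Adj] (e : V → ℤ)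
    (m s t : ℤ) : Decidable (B.IsCoExcess e m s t) := by
  unfold IsCoExcess
  infer_instance

/-- Some graph on `n` vertices carries a weight satisfying `IsCoExcess`. -/
def HasCoExcess (m s t : ℤ) (n : ℕ) : Prop :=
  ∃ (B : SimpleGraph (Fin n)) (_ : DecidableRel B.Adj) (e : Fin n → ℤ), B.IsCoExcess e m s t

theorem HasCoExcess.add {m s t t' : ℤ} {a b : ℕ} (ha : HasCoExcess m s t a)
    (hb : HasCoExcess m s t' b) : HasCoExcess m s (t + t') (a + b) := by
  classical
  obtain ⟨B, _, e, he, ⟨i₀, j₀, hne⟩, hdeg, hnbr, htot⟩ := ha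
  obtain ⟨C, _, f, hf, -, hdeg', hnbr', htot'⟩ := hb
  let φ : Fin (a + b) ≃ Fin a ⊕ Fin b := finSumFinEquiv.symm
  refine ⟨(B ⊕g C).comap φ, Classical.decRel _, fun i => Sum.elim e f (φ i), ?_, ?_, ?_, ?_, ?_⟩
  · intro i
    beta_reduce
    rcases φ i with x | x
    exacts [he x, hf x]
  · exact ⟨φ.symm (.inl i₀), φ.symm (.inl j₀), by simpa using hne⟩
  · intro i
    simp only [comap_adj]
    rw [φ.sum_comp fun x => if (B ⊕g C).Adj (φ i) x then (1 : ℤ) else 0, Fintype.sum_sum_type]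
    rcases φ i with x | x
    · simpa using hdeg x
    · simpa using hdeg' x
  · intro i
    simp only [comap_adj]
    rw [φ.sum_comp fun x => if (B ⊕g C).Adj (φ i) x then Sum.elim e f x else 0,
      Fintype.sum_sum_type]
    rcases φ i with x | x
    · simpa using hnbr x
    · simpa using hnbr' x
  · rw [φ.sum_comp (Sum.elim e f), Fintype.sum_sum_type]
    simp [htot, htot']

theorem HasCoExcess.exists_isPseudoRegular {m k : ℕ} {s : ℤ} (hk : 3 ≤ k)
    (h : HasCoExcess m s s (k + (m + 1))) :
    ∃ G : SimpleGraph (Fin (k + (m + 1))), G.IsPseudoRegular k := by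
  classical
  obtain ⟨B, _, e, he, ⟨i₀, j₀, hne⟩, hdeg, hnbr, htot⟩ := h
  have adj_compl (f : Fin (k + (m + 1)) → ℤ) (i) :
      ∑ j ∈ Bᶜ.neighborFinset i, f j = ∑ j, f j - f i - ∑ j, (if B.Adj i j then f j else 0) := by
    have h1 : f i = ∑ j, if j = i then f j else 0 := by simp
    rw [neighborFinset_eq_filter, sum_filter, h1, ← sum_sub_distrib, ← sum_sub_distrib]
    refine sum_congr rfl fun j _ => ?_
    by_cases hij : j = i
    · subst hij; simp
    · by_cases hB : B.Adj i j <;> simp [hij, Ne.symm hij, hB]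
  have deg (i) : (Bᶜ.degree i : ℤ) = k + e i := by
    have := adj_compl (fun _ => 1) i
    rw [hdeg] at this
    simp only [sum_const, card_univ, Fintype.card_fin, card_neighborFinset_eq_degree] at this
    push_cast [nsmul_eq_mul] at this
    linarith
  refine ⟨Bᶜ, fun i => ?_, fun i => ?_, ?_⟩
  · have h1 := deg i
    have h2 := he i
    convert (by omega : 0 < Bᶜ.degree i)
  · have key : ((∑ j ∈ Bᶜ.neighborFinset i, Bᶜ.degree j : ℕ) : ℤ) = (k * Bᶜ.degree i : ℕ) := by
      push_cast
      simp only [deg, sum_add_distrib]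
      rw [adj_compl e, adj_compl fun _ => (k : ℤ), hnbr, htot]
      have h3 : ∑ j, (if B.Adj i j then (k : ℤ) else 0) = k * (m - e i) := by
        rw [← hdeg, mul_sum]; simp
      rw [h3]
      simp only [sum_const, card_univ, Fintype.card_fin, nsmul_eq_mul]
      push_cast
      ring
    convert Nat.cast_injective key
  · rintro ⟨d, hd⟩
    have h (i) : (k : ℤ) + e i = d := by
      rw [← deg, ← hd i]
      congr!
    exact hne (by linarith [h i₀, h j₀])

theorem hasCoExcess_odd (r : ℕ) : HasCoExcess 3 (-1) (-1) (2 * r + 5) := by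
  induction r using Nat.strong_induction_on with | _ r ih
  rcases lt_or_ge r 3 with hr | hr
  · have base5 : HasCoExcess 3 (-1) (-1) 5 :=
      ⟨ofRows ![30, 13, 19, 19, 13], inferInstance, ![-1, 0, 0, 0, 0], by decide +kernel⟩
    have base7 : HasCoExcess 3 (-1) (-1) 7 :=
      ⟨ofRows ![78, 113, 25, 37, 38, 26, 3], inferInstance, ![-1, -1, 0, 0, 0, 0, 1],
        by decide +kernel⟩
    have base9 : HasCoExcess 3 (-1) (-1) 9 :=
      ⟨ofRows ![202, 389, 306, 81, 44, 84, 41, 3, 6], inferInstance,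
        ![-1, -1, -1, 0, 0, 0, 0, 1, 1], by decide +kernel⟩
    interval_cases r
    exacts [base5, base7, base9]
  · have block : HasCoExcess 3 (-1) 0 6 :=
      ⟨ofRows ![30, 53, 43, 5, 3, 6], inferInstance, ![-1, -1, -1, 1, 1, 1], by decide +kernel⟩
    have h := (ih (r - 3) (by omega)).add block
    rwa [add_zero, show 2 * (r - 3) + 5 + 6 = 2 * r + 5 by omega] at h

theorem hasCoExcess_even (r : ℕ) : HasCoExcess 5 (-2) (-2) (2 * r + 8) := by
  induction r using Nat.strong_induction_on with | _ r ih
  rcases lt_or_ge r 6 with hr | hr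
  · have base8 : HasCoExcess 5 (-2) (-2) 8 :=
      ⟨ofRows ![254, 217, 241, 227, 167, 93, 47, 31],
        inferInstance, ![-2, 0, 0, 0, 0, 0, 0, 0], by decide +kernel⟩
    have base10 : HasCoExcess 5 (-2) (-2) 10 :=
      ⟨ofRows ![878, 917, 915, 241, 110, 217, 185, 110, 519, 263],
        inferInstance, ![-2, -1, -1, 0, 0, 0, 0, 0, 1, 1], by decide +kernel⟩
    have base12 : HasCoExcess 5 (-2) (-2) 12 :=
      ⟨ofRows ![1016, 748, 3226, 3335, 3173, 3091, 787, 775, 201, 195, 60, 60],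
        inferInstance, ![-2, -1, -1, -1, -1, 0, 0, 0, 1, 1, 1, 1], by decide +kernel⟩
    have base14 : HasCoExcess 5 (-2) (-2) 14 :=
      ⟨ofRows ![9728, 14336, 3352, 5268, 8364, 6480, 1952, 2648, 4708, 10689, 12365, 8870, 9514,
          7699],
        inferInstance, ![2, 2, 0, 0, 0, 0, 0, 0, 0, -1, -1, -1, -1, -2], by decide +kernel⟩
    have base16 : HasCoExcess 5 (-2) (-2) 16 :=
      ⟨ofRows ![49454, 49181, 24723, 38931, 13326, 13889, 4000, 2884, 6337, 3296, 8816, 968, 312,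
          1076, 7, 11],
        inferInstance, ![-2, -1, -1, -1, -1, -1, -1, 0, 0, 0, 0, 0, 1, 1, 2, 2],
          by decide +kernel⟩
    have base18 : HasCoExcess 5 (-2) (-2) 18 :=
      ⟨ofRows ![197262, 196665, 196697, 53255, 21030, 25874, 36612, 44289, 14560, 41041, 18656,
          5568, 2328, 928, 1080, 712, 7, 7],
        inferInstance, ![-2, -1, -1, -1, -1, -1, -1, -1, -1, 0, 0, 0, 1, 1, 1, 1, 2, 2],
          by decide +kernel⟩
    interval_cases r
    exacts [base8, base10, base12, base14, base16, base18]
  · have block : HasCoExcess 5 (-2) 0 12 :=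
      ⟨ofRows ![2568, 3200, 1600, 3121, 2472, 2392, 1828, 1810, 752, 3525, 2766, 1595],
        inferInstance, ![2, 2, 2, 0, 0, 0, 0, 0, 0, -2, -2, -2], by decide +kernel⟩
    have h := (ih (r - 6) (by omega)).add block
    rwa [add_zero, show 2 * (r - 6) + 8 + 12 = 2 * r + 8 by omega] at h

end SimpleGraph

/-- Let `k ≥ 3`. If `k` is odd, there exists a pseudo `k`-regular
graph on `k + 4` vertices; if `k` is even, there exists a pseudo `k`-regular graph on
`k + 6` vertices. (In particular, `N(k) ≤ k + 4` for odd `k` and `N(k) ≤ k + 6` for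
even `k`.) -/
theorem exists_small_pseudoRegular (k : ℕ) (hk : 3 ≤ k) :
    (Odd k → ∃ G : SimpleGraph (Fin (k + 4)), G.IsPseudoRegular k) ∧
    (Even k → ∃ G : SimpleGraph (Fin (k + 6)), G.IsPseudoRegular k) := by
  refine ⟨?_, ?_⟩
  · rintro ⟨r, rfl⟩
    exact SimpleGraph.HasCoExcess.exists_isPseudoRegular (m := 3) hk
      (SimpleGraph.hasCoExcess_odd r)
  · rintro ⟨r, rfl⟩
    have h := SimpleGraph.hasCoExcess_even (r - 1)
    rw [show 2 * (r - 1) + 8 = r + r + (5 + 1) by omega] at h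
    exact h.exists_isPseudoRegular (m := 5) hk
end
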